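/- arXiv:1204.6566 — 7 statements merged into one kernel-verified Lean document; each statement's English description precedes it below -/
import Mathlib

section
/- Let G be a nilpotent group and X any group with Hom(X, G) = 0. Then for every finite normal subgroup H of G, Hom(X, G/H) = 0. -/
open scoped commutatorElement

theorem exists_mem_notMem_forall_commutatorElement_mem {G : Type*} [Group G] [Group.IsNilpotent G]
    {H N : Subgroup G} [hHn : H.Normal] (hHN : ¬ H ≤ N) :
    ∃ h ∈ H, h ∉ N ∧ ∀ g : G, ⁅h, g⁆ ∈ N := by
  classical
  have hex : ∃ n, ¬ H ⊓ Subgroup.upperCentralSeries G n ≤ N := by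
    obtain ⟨n, hn⟩ := Group.IsNilpotent.nilpotent G
    exact ⟨n, by rwa [hn, inf_top_eq]⟩
  obtain ⟨n, hn, hmin⟩ : ∃ n, ¬ H ⊓ Subgroup.upperCentralSeries G n ≤ N ∧
      ∀ m < n, H ⊓ Subgroup.upperCentralSeries G m ≤ N :=
    ⟨Nat.find hex, Nat.find_spec hex, fun m hm => not_not.mp (Nat.find_min hex hm)⟩
  cases n with
  | zero => exact absurd (by simp) hn
  | succ k =>
    obtain ⟨h, ⟨hH, hZ⟩, hN⟩ := SetLike.not_le_iff_exists.mp hn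
    refine ⟨h, hH, hN, fun g => hmin k k.lt_succ_self
      ⟨?_, Subgroup.mem_upperCentralSeries_succ_iff.mp hZ g⟩⟩
    have hconj : g * h⁻¹ * g⁻¹ ∈ H := hHn.conj_mem _ (H.inv_mem hH) g
    simpa [commutatorElement_def, mul_assoc] using H.mul_mem hH hconj

/-- Commuting with an element of the second centre is a homomorphism. -/
def commutatorHom {G : Type*} [Group G] (y : G) (hy : ∀ g : G, ⁅g, y⁆ ∈ Subgroup.center G) :
    G →* G where
  toFun g := ⁅g, y⁆
  map_one' := commutatorElement_one_left y
  map_mul' a b := by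
    have hb := Subgroup.mem_center_iff.mp (hy b) a
    calc ⁅a * b, y⁆ = a * ⁅b, y⁆ * (y * a⁻¹ * y⁻¹) := by
          simp only [commutatorElement_def]; group
      _ = ⁅b, y⁆ * ⁅a, y⁆ := by
          rw [hb]; simp only [commutatorElement_def]; group
      _ = ⁅a, y⁆ * ⁅b, y⁆ := (Subgroup.mem_center_iff.mp (hy b) _).symm

theorem exists_monoidHom_ne_one_of_ker_le_ker {G Q A : Type*} [Group G] [Group Q] [Group A]
    {φ : G →* Q} (hφ : Function.Surjective φ) (ψ : G →* A) (hker : φ.ker ≤ ψ.ker) (hψ : ψ ≠ 1) :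
    ∃ θ : Q →* A, θ ≠ 1 := by
  refine ⟨φ.liftOfSurjective hφ ⟨ψ, hker⟩, fun h1 => hψ ?_⟩
  ext g
  have := DFunLike.congr_fun h1 (φ g)
  simpa using this

theorem AddMonoidHom.exists_rightInverse_of_prime_nsmul_eq_zero {p : ℕ} (hp : p.Prime)
    {A B : Type*} [AddCommGroup A] [AddCommGroup B] (hA : ∀ a : A, p • a = 0)
    (hB : ∀ b : B, p • b = 0) {f : A →+ B} (hf : Function.Surjective f) :
    ∃ s : B →+ A, Function.RightInverse s f := by
  have : Fact p.Prime := ⟨hp⟩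
  have : Module (ZMod p) A := AddCommGroup.zmodModule hA
  have : Module (ZMod p) B := AddCommGroup.zmodModule hB
  obtain ⟨s, hs⟩ := (f.toZModLinearMap p).exists_rightInverse_of_surjective
    (LinearMap.range_eq_top.mpr hf)
  exact ⟨s.toAddMonoidHom, LinearMap.congr_fun hs⟩

theorem CommGroup.exists_monoidHom_ne_one_of_card_ker_prime {G Q : Type*} [CommGroup G]
    [CommGroup Q] [Nontrivial Q] {φ : G →* Q} (hφ : Function.Surjective φ)
    (hp : (Nat.card φ.ker).Prime) : ∃ θ : Q →* G, θ ≠ 1 := by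
  obtain ⟨p, hpc⟩ : ∃ p, Nat.card φ.ker = p := ⟨_, rfl⟩
  rw [hpc] at hp
  by_cases hpow : powMonoidHom p = (1 : G →* G)
  · have hG : ∀ g : G, g ^ p = 1 := DFunLike.congr_fun hpow
    have hQ : ∀ q : Q, q ^ p = 1 := fun q => by
      obtain ⟨g, rfl⟩ := hφ q
      rw [← map_pow, hG, map_one]
    obtain ⟨s, hs⟩ := AddMonoidHom.exists_rightInverse_of_prime_nsmul_eq_zero hp
      (A := Additive G) (B := Additive Q) hG hQ (f := φ.toAdditive) hφ
    refine ⟨MonoidHom.toAdditive.symm s, fun h1 => ?_⟩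
    obtain ⟨q, hq⟩ := exists_ne (1 : Q)
    refine hq ?_
    have hsq : φ (MonoidHom.toAdditive.symm s q) = q := hs (Additive.ofMul q)
    rw [← hsq, h1, MonoidHom.one_apply, map_one]
  · refine exists_monoidHom_ne_one_of_ker_le_ker hφ _ (fun g hg => ?_) hpow
    rw [← hpc]
    exact congrArg Subtype.val (pow_card_eq_one' (x := (⟨g, hg⟩ : φ.ker)))

theorem exists_monoidHom_ne_one_of_card_ker_prime {G Q : Type*} [Group G] [Group.IsNilpotent G]
    [Group Q] [Nontrivial Q] {φ : G →* Q} (hφ : Function.Surjective φ)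
    (hc : φ.ker ≤ Subgroup.center G) (hp : (Nat.card φ.ker).Prime) : ∃ θ : Q →* G, θ ≠ 1 := by
  by_cases hcomm : (⊤ : Subgroup G) ≤ Subgroup.center G
  · have hmul : ∀ a b : G, a * b = b * a := fun a b =>
      Subgroup.mem_center_iff.mp (hcomm (Subgroup.mem_top b)) a
    let : CommGroup G := { ‹Group G› with mul_comm := hmul }
    let : CommGroup Q := { ‹Group Q› with
      mul_comm := fun a b => by
        obtain ⟨a, rfl⟩ := hφ a
        obtain ⟨b, rfl⟩ := hφ b
        rw [← map_mul, hmul, map_mul] }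
    exact CommGroup.exists_monoidHom_ne_one_of_card_ker_prime hφ hp
  · obtain ⟨y, -, hy, hyc⟩ := exists_mem_notMem_forall_commutatorElement_mem hcomm
    have hyc' : ∀ g : G, ⁅g, y⁆ ∈ Subgroup.center G := fun g => by
      rw [← commutatorElement_inv]
      exact inv_mem (hyc g)
    refine exists_monoidHom_ne_one_of_ker_le_ker hφ (commutatorHom y hyc') (fun g hg => ?_)
      (fun h1 => hy ?_)
    · exact commutatorElement_eq_one_iff_mul_comm.mpr (Subgroup.mem_center_iff.mp (hc hg) y).symm
    · exact Subgroup.mem_center_iff.mpr fun g =>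
        commutatorElement_eq_one_iff_mul_comm.mp (DFunLike.congr_fun h1 g)

theorem monoidHom_eq_one_of_card_ker_prime {G Q X : Type*} [Group G] [Group.IsNilpotent G]
    [Group Q] [Group X] (h : ∀ f : X →* G, f = 1) {φ : G →* Q} (hφ : Function.Surjective φ)
    (hc : φ.ker ≤ Subgroup.center G) (hp : (Nat.card φ.ker).Prime) (f : X →* Q) : f = 1 := by
  by_contra hf
  let K : Subgroup G := f.range.comap φ
  let φK : K →* f.range := φ.subgroupComap f.range
  have hφK : Function.Surjective φK := φ.subgroupComap_surjective_of_surjective f.range hφ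
  have : Nontrivial f.range := by
    rw [Subgroup.nontrivial_iff_ne_bot]
    exact fun hb => hf (f.range_eq_bot_iff.mp hb)
  have hmem : ∀ k : K, k ∈ φK.ker ↔ (k : G) ∈ φ.ker := fun _ => Subtype.ext_iff
  have hcK : φK.ker ≤ Subgroup.center K := fun k hk => Subgroup.mem_center_iff.mpr fun g =>
    Subtype.ext (Subgroup.mem_center_iff.mp (hc ((hmem k).mp hk)) g)
  have hcard : Nat.card φK.ker = Nat.card φ.ker := by
    have hle : φ.ker ≤ K := φ.ker_le_comap f.range
    have : φK.ker = φ.ker.subgroupOf K := by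
      ext k
      rw [hmem, Subgroup.mem_subgroupOf]
    rw [this]
    exact Nat.card_congr (Subgroup.subgroupOfEquivOfLe hle).toEquiv
  obtain ⟨θ, hθ⟩ := exists_monoidHom_ne_one_of_card_ker_prime hφK hcK (hcard ▸ hp)
  refine hθ ?_
  have hcomp := h (K.subtype.comp (θ.comp f.rangeRestrict))
  ext q
  obtain ⟨x, rfl⟩ := f.rangeRestrict_surjective q
  simpa using DFunLike.congr_fun hcomp x

theorem monoidHom_eq_one_of_finite_ker {G Q X : Type*} [Group G] [Group.IsNilpotent G]
    [Group Q] [Group X] (h : ∀ f : X →* G, f = 1) {φ : G →* Q} (hφ : Function.Surjective φ)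
    (hfin : Finite φ.ker) (f : X →* Q) : f = 1 := by
  induction hn : Nat.card φ.ker using Nat.strong_induction_on generalizing G with
  | _ n ih =>
    by_cases hbot : φ.ker ≤ ⊥
    · let e := MulEquiv.ofBijective φ ⟨φ.ker_eq_bot_iff.mp (le_bot_iff.mp hbot), hφ⟩
      have hcomp := h (e.symm.toMonoidHom.comp f)
      ext x
      simpa using DFunLike.congr_fun hcomp x
    · obtain ⟨z, hz, hz1, hzc⟩ := exists_mem_notMem_forall_commutatorElement_mem hbot
      have hzfin : IsOfFinOrder z :=
        φ.ker.subtype.isOfFinOrder (isOfFinOrder_of_finite (⟨z, hz⟩ : φ.ker))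
      have hzcenter : z ∈ Subgroup.center G := Subgroup.mem_center_iff.mpr fun g =>
        (commutatorElement_eq_one_iff_mul_comm.mp (hzc g)).symm
      obtain ⟨p, hp, hdvd⟩ := Nat.exists_prime_and_dvd
        (fun ho => hz1 (orderOf_eq_one_iff.mp ho) : orderOf z ≠ 1)
      let c := z ^ (orderOf z / p)
      have hoc : orderOf c = p := orderOf_pow_orderOf_div hzfin.orderOf_pos.ne' hdvd
      let C := Subgroup.zpowers c
      have hCc : C ≤ Subgroup.center G := Subgroup.zpowers_le.mpr (pow_mem hzcenter _)
      have hcφ : c ∈ φ.ker := pow_mem hz _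
      have hCφ : C ≤ φ.ker := Subgroup.zpowers_le.mpr hcφ
      have : C.Normal := ⟨fun k hk g => by
        rwa [Subgroup.mem_center_iff.mp (hCc hk) g, mul_inv_cancel_right]⟩
      have hquot : ∀ f : X →* G ⧸ C, f = 1 :=
        monoidHom_eq_one_of_card_ker_prime h (QuotientGroup.mk'_surjective C)
          (by rwa [QuotientGroup.ker_mk'])
          (by rwa [QuotientGroup.ker_mk', Nat.card_zpowers, hoc])
      have hker := QuotientGroup.ker_lift C φ hCφ
      have hfin' : (φ.ker : Set G).Finite := hfin
      have hfinm : Finite (QuotientGroup.lift C φ hCφ).ker := by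
        rw [hker]
        exact hfin'.image _
      refine ih _ ?_ hquot (QuotientGroup.lift_surjective_of_surjective C φ hφ hCφ) hfinm rfl
      rw [hker, ← hn]
      change ((QuotientGroup.mk' C) '' (φ.ker : Set G)).ncard < (φ.ker : Set G).ncard
      refine lt_of_le_of_ne (Set.ncard_image_le hfin') fun heq => ?_
      have hinj := (Set.ncard_image_iff hfin').mp heq
      have hc1 : c = 1 := hinj hcφ φ.ker.one_mem <| by
        rw [map_one]
        exact (QuotientGroup.eq_one_iff c).mpr (Subgroup.mem_zpowers c)
      exact hp.one_lt.ne (by rw [← hoc, hc1, orderOf_one])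

/-- Let `G` be a nilpotent group and `X` any group with
`Hom(X, G) = 0`. Then for every finite normal subgroup `H` of `G`,
`Hom(X, G/H) = 0`. -/
theorem stmt5 {G X : Type*} [Group G] [Group X] [Group.IsNilpotent G]
    (h : ∀ f : X →* G, f = 1)
    (H : Subgroup G) [H.Normal] (hH : Finite H) :
    ∀ f : X →* G ⧸ H, f = 1 :=
  monoidHom_eq_one_of_finite_ker h (QuotientGroup.mk'_surjective H)
    (by rwa [QuotientGroup.ker_mk'])
end

section
/- Let G be a nilpotent group and H a finite group with Hom(G, H) = 0. Then the function G → G given by g ↦ g^{|H|} (the |H|-th power map, where |H| is the order of H) is surjective. -/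
/-- In an additive group of prime exponent `p`, homomorphisms to `ZMod p` separate points. -/
theorem eq_zero_of_forall_addMonoidHom_zmod_eq_zero {V : Type*} [AddCommGroup V] {p : ℕ}
    [Fact p.Prime] (hV : ∀ x : V, p • x = 0) {v : V} (hv : ∀ φ : V →+ ZMod p, φ v = 0) :
    v = 0 := by
  have : Module (ZMod p) V := AddCommGroup.zmodModule hV
  exact (Module.forall_dual_apply_eq_zero_iff (ZMod p) v).1 fun φ => hv φ.toAddMonoidHom

/-- A commutative group admitting only trivial homomorphisms to a finite group `H` is `p`-divisible
for every prime `p` dividing the order of `H`. -/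
theorem pow_prime_surjective_of_forall_hom_eq_one {A H : Type*} [CommGroup A] [Group H] [Finite H]
    (h : ∀ f : A →* H, f = 1) {p : ℕ} (hp : p.Prime) (hpH : p ∣ Nat.card H) :
    Function.Surjective (fun a : A => a ^ p) := by
  have : Fact p.Prime := ⟨hp⟩
  obtain ⟨t, ht⟩ := exists_prime_orderOf_dvd_card' p hpH
  let P : Subgroup A := (powMonoidHom p : A →* A).range
  have hkill : ∀ x : Additive (A ⧸ P), p • x = 0 := by
    intro x
    obtain ⟨a, ha⟩ := QuotientGroup.mk_surjective x.toMul
    have : x.toMul ^ p = 1 := by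
      rw [← ha, ← QuotientGroup.mk_pow, QuotientGroup.eq_one_iff]
      exact ⟨a, rfl⟩
    exact congrArg Additive.ofMul this
  let e : ZMod p →+ Additive H := ZMod.lift p
    ⟨zmultiplesHom (Additive H) (Additive.ofMul t), by
      have : t ^ p = 1 := ht ▸ pow_orderOf_eq_one t
      simpa using congrArg Additive.ofMul this⟩
  have he : Function.Injective e := by
    rw [ZMod.lift_injective]
    intro m hm
    rw [ZMod.intCast_zmod_eq_zero_iff_dvd, ← ht, orderOf_dvd_iff_zpow_eq_one]
    simpa using congrArg Additive.toMul hm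
  intro a
  have ha : Additive.ofMul (a : A ⧸ P) = 0 := by
    refine eq_zero_of_forall_addMonoidHom_zmod_eq_zero hkill fun φ => ?_
    have := DFunLike.congr_fun
      (h ((AddMonoidHom.toMultiplicative (e.comp φ)).comp (QuotientGroup.mk' P))) a
    exact he (this.trans (map_zero e).symm)
  exact (QuotientGroup.eq_one_iff a).1 (congrArg Additive.toMul ha)

theorem pow_surjective_of_forall_prime {M : Type*} [Monoid M] (n : ℕ) (hn : n ≠ 0)
    (h : ∀ p : ℕ, p.Prime → p ∣ n → Function.Surjective (fun a : M => a ^ p)) :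
    Function.Surjective (fun a : M => a ^ n) := by
  induction n using Nat.recOnMul with
  | zero => exact absurd rfl hn
  | one => exact fun a => ⟨a, pow_one a⟩
  | prime p hp => exact h p hp dvd_rfl
  | mul a b iha ihb =>
    obtain ⟨ha, hb⟩ := mul_ne_zero_iff.1 hn
    intro x
    obtain ⟨y, rfl⟩ := ihb hb (fun p hp hd => h p hp (hd.mul_left a)) x
    obtain ⟨z, rfl⟩ := iha ha (fun p hp hd => h p hp (hd.mul_right b)) y
    exact ⟨z, pow_mul z a b⟩

open scoped commutatorElement IsMulCommutative in
/-- If the abelianization of `G` is `n`-divisible, then so is any central subgroup of the form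
`⁅N, ⊤⁆`. -/
theorem exists_pow_eq_of_mem_commutator_of_le_center {G : Type*} [Group G] {n : ℕ}
    (hdiv : Function.Surjective (fun a : Abelianization G => a ^ n)) {N : Subgroup G}
    (hN : ⁅N, (⊤ : Subgroup G)⁆ ≤ Subgroup.center G) {z : G} (hz : z ∈ ⁅N, (⊤ : Subgroup G)⁆) :
    ∃ w ∈ Subgroup.center G, w ^ n = z := by
  suffices ⁅N, (⊤ : Subgroup G)⁆ ≤
      ((powMonoidHom n : Subgroup.center G →* Subgroup.center G).range).map
        (Subgroup.center G).subtype by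
    obtain ⟨_, ⟨w, rfl⟩, rfl⟩ := this hz
    exact ⟨w, w.2, rfl⟩
  rw [Subgroup.commutator_le]
  intro a ha b _
  have hc : ∀ x : G, ⁅a, x⁆ ∈ Subgroup.center G := fun x =>
    hN (Subgroup.commutator_mem_commutator ha (Subgroup.mem_top x))
  let f : G →* Subgroup.center G := MonoidHom.mk' (fun x => ⟨⁅a, x⁆, hc x⟩) fun x y =>
    Subtype.ext <| by
      have := Subgroup.mem_center_iff.1 (hc y) x
      calc ⁅a, x * y⁆ = ⁅a, x⁆ * (x * ⁅a, y⁆) * x⁻¹ := by simp only [commutatorElement_def]; group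
        _ = ⁅a, x⁆ * ⁅a, y⁆ := by rw [this]; group
  obtain ⟨u, hu⟩ := hdiv (Abelianization.of b)
  refine ⟨f b, ⟨Abelianization.lift f u, ?_⟩, rfl⟩
  have := congrArg (Abelianization.lift f) hu
  simpa using this

open scoped commutatorElement in
/-- A nilpotent group with `n`-divisible abelianization is `n`-divisible. -/
theorem pow_surjective_of_lowerCentralSeries_eq_bot {G : Type*} [Group G] {n : ℕ}
    (hdiv : Function.Surjective (fun a : Abelianization G => a ^ n)) (c : ℕ)
    (hc : (⊤ : Subgroup G).lowerCentralSeries c = ⊥) :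
    Function.Surjective (fun g : G => g ^ n) := by
  induction c generalizing G with
  | zero =>
    intro g
    have hg : ∀ x : G, x = 1 := fun x => by
      rw [← Subgroup.mem_bot, ← hc]; exact Subgroup.mem_top x
    exact ⟨1, (hg _).trans (hg g).symm⟩
  | succ c ih =>
    let K := (⊤ : Subgroup G).lowerCentralSeries c
    have hK : K ≤ Subgroup.center G := by
      intro x hx
      rw [Subgroup.mem_center_iff]
      intro y
      have : ⁅x, y⁆ ∈ (⊤ : Subgroup G).lowerCentralSeries (c + 1) :=
        Subgroup.commutator_mem_commutator hx (Subgroup.mem_top y)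
      rw [hc, Subgroup.mem_bot, commutatorElement_eq_one_iff_mul_comm] at this
      exact this.symm
    cases c with
    | zero =>
      intro g
      obtain ⟨u, hu⟩ := hdiv (Abelianization.of g)
      obtain ⟨x, rfl⟩ := QuotientGroup.mk_surjective u
      refine ⟨x, ?_⟩
      have : (x ^ n)⁻¹ * g ∈ commutator G := QuotientGroup.eq.1 hu
      rw [← Subgroup.top_lowerCentralSeries_one, hc, Subgroup.mem_bot, inv_mul_eq_one] at this
      exact this
    | succ c =>
      have hq : Function.Surjective (fun g : G ⧸ K => g ^ n) := by
        apply ih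
        · intro v
          obtain ⟨q, rfl⟩ := QuotientGroup.mk_surjective v
          obtain ⟨g, rfl⟩ := QuotientGroup.mk_surjective q
          obtain ⟨u, hu⟩ := hdiv (Abelianization.of g)
          refine ⟨Abelianization.map (QuotientGroup.mk' K) u, ?_⟩
          have := congrArg (Abelianization.map (QuotientGroup.mk' K)) hu
          exact (map_pow _ _ _).symm.trans this
        · have := (⊤ : Subgroup G).map_lowerCentralSeries (QuotientGroup.mk' K) (c + 1)
          rw [Subgroup.map_top_of_surjective _ (QuotientGroup.mk'_surjective K)] at this
          rw [← this, Subgroup.map_eq_bot_iff, QuotientGroup.ker_mk']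
      intro g
      obtain ⟨q, hq⟩ := hq g
      obtain ⟨x, rfl⟩ := QuotientGroup.mk_surjective q
      have hz : (x ^ n)⁻¹ * g ∈ K := QuotientGroup.eq.1 hq
      obtain ⟨w, hw, hwz⟩ := exists_pow_eq_of_mem_commutator_of_le_center hdiv hK hz
      refine ⟨x * w, ?_⟩
      have hxw : Commute x w := Subgroup.mem_center_iff.1 hw x
      simp only [hxw.mul_pow, hwz, mul_inv_cancel_left]

/-- Let `G` be a nilpotent group and `H` a finite group with
`Hom(G, H) = 0`. Then the `|H|`-th power map `g ↦ g ^ |H|` on `G` is surjective. -/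
theorem stmt8 {G H : Type*} [Group G] [Group H] [Group.IsNilpotent G] [Finite H]
    (h : ∀ f : G →* H, f = 1) :
    Function.Surjective (fun g : G => g ^ Nat.card H) := by
  have hA : ∀ f : Abelianization G →* H, f = 1 := fun f =>
    Abelianization.hom_ext _ _ ((h _).trans (h _).symm)
  obtain ⟨c, hc⟩ := Subgroup.nilpotent_iff_lowerCentralSeries.1 ‹Group.IsNilpotent G›
  exact pow_surjective_of_lowerCentralSeries_eq_bot
    (pow_surjective_of_forall_prime _ Nat.card_pos.ne' fun _ hp hd =>
      pow_prime_surjective_of_forall_hom_eq_one hA hp hd) c hc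
end

section
/- A group homomorphism a : X → G is a generalized subgroup of G (i.e., the map Hom(X, X) → Hom(X, G), f ↦ a ∘ f, is injective) if and only if the following two conditions hold: (a) the kernel of a is contained in the center of X; and (b) Hom(X, Ker(a)) = 0, i.e., the only group homomorphism from X to the group Ker(a) is the trivial one. -/
/-- A group homomorphism `a : X → G` is a generalized subgroup of
`G` (i.e. `Hom(X, X) → Hom(X, G)`, `f ↦ a ∘ f`, is injective) if and only if
(a) the kernel of `a` is contained in the center of `X`, and
(b) the only homomorphism from `X` to `Ker(a)` is the trivial one. -/
theorem stmt10 {X G : Type*} [Group X] [Group G] (a : X →* G) :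
    Function.Injective (fun f : X →* X => a.comp f) ↔
      (a.ker ≤ Subgroup.center X ∧ ∀ f : X →* a.ker, f = 1) := by
  constructor
  · intro h
    refine ⟨fun k hk => Subgroup.mem_center_iff.mpr fun x => ?_, fun f => ?_⟩
    · have hk1 : a k = 1 := hk
      have hconj : (MulAut.conj k).toMonoidHom = MonoidHom.id X := by
        apply h
        ext y
        simp [hk1]
      have hx : k * x * k⁻¹ = x := by simpa using DFunLike.congr_fun hconj x
      exact (mul_inv_eq_iff_eq_mul.mp hx).symm
    · have hf : a.ker.subtype.comp f = 1 := by
        apply h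
        ext y
        have hy : a (f y) = 1 := (f y).2
        simp [hy]
      ext y
      simpa using DFunLike.congr_fun hf y
  · rintro ⟨hc, ht⟩ f g hfg
    have hag : ∀ x, a (f x) = a (g x) := fun x => DFunLike.congr_fun hfg x
    have hker : ∀ x, f x * (g x)⁻¹ ∈ a.ker := fun x => by
      simp [MonoidHom.mem_ker, hag x]
    let d : X →* a.ker := MonoidHom.mk' (fun x => ⟨f x * (g x)⁻¹, hker x⟩) fun x y => by
      have hcomm := Subgroup.mem_center_iff.mp (hc (hker y)) (g x)⁻¹
      apply Subtype.ext
      change f (x * y) * (g (x * y))⁻¹ = f x * (g x)⁻¹ * (f y * (g y)⁻¹)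
      rw [mul_assoc (f x), hcomm]
      simp [mul_assoc]
    ext x
    have hd : f x * (g x)⁻¹ = 1 := congrArg Subtype.val (DFunLike.congr_fun (ht d) x)
    exact mul_inv_eq_one.mp hd
end

section
/- Let a : X → G be a generalized subgroup with G finitely generated and nilpotent. Then a is injective; in particular X is isomorphic to a subgroup of G and hence is itself finitely generated and nilpotent. -/
namespace Subgroup

open scoped commutatorElement

variable {G K : Type*} [Group G] [Group K]

/-- A subgroup is finitely generated if its image under a homomorphism and its intersection with
the kernel are. -/
theorem fg_of_fg_map_of_fg_inf_ker (f : G →* K) (H : Subgroup G) (hmap : (H.map f).FG)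
    (hker : (H ⊓ f.ker).FG) : H.FG := by
  classical
  obtain ⟨T, hT⟩ := hmap
  have hTsub : (T : Set K) ⊆ f '' (H : Set G) := by
    rw [← coe_map, ← hT]
    exact subset_closure
  obtain ⟨U, hT'H, hT'⟩ := Finset.subset_set_image_iff.mp hTsub
  have hcl : (closure (U : Set G)).map f = H.map f := by
    rw [MonoidHom.map_closure, ← hT, ← hT', Finset.coe_image]
  have hle : closure (U : Set G) ≤ H := (closure_le H).mpr hT'H
  have hH : H = closure (U : Set G) ⊔ (H ⊓ f.ker) := by
    refine le_antisymm (fun x hx => ?_) (sup_le hle inf_le_left)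
    obtain ⟨y, hy, hyx⟩ : f x ∈ (closure (U : Set G)).map f := hcl ▸ mem_map_of_mem f hx
    have hz : y⁻¹ * x ∈ H ⊓ f.ker :=
      ⟨H.mul_mem (H.inv_mem (hle hy)) hx, by simp [hyx]⟩
    simpa using mul_mem_sup hy hz
  rw [hH]
  exact FG.sup ⟨U, rfl⟩ hker

/-- Subgroups of finitely generated commutative groups are finitely generated. -/
theorem fg_of_commGroup_fg {A : Type*} [CommGroup A] [Group.FG A] (H : Subgroup A) : H.FG := by
  have : Module.Finite ℤ (Additive A) :=
    Module.Finite.iff_addGroup_fg.mpr (GroupFG.iff_add_fg.mp inferInstance)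
  rw [fg_iff_add_fg]
  have h : (AddSubgroup.toIntSubmodule H.toAddSubgroup).FG := IsNoetherian.noetherian _
  rw [Submodule.fg_iff_addSubgroup_fg] at h
  exact h

/-- Subgroups of a finitely generated central subgroup are finitely generated. -/
theorem FG.of_le_of_le_center {L H : Subgroup G} (hL : L.FG) (hc : L ≤ center G) (hH : H ≤ L) :
    H.FG := by
  classical
  let _ : CommGroup L :=
    { mul_comm := fun x y => Subtype.ext ((mem_center_iff.mp (hc y.2)) x) }
  have : Group.FG L := (Group.fg_iff_subgroup_fg L).mpr hL
  obtain ⟨T, hT⟩ := fg_of_commGroup_fg (H.subgroupOf L)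
  refine ⟨T.image L.subtype, ?_⟩
  rw [Finset.coe_image, ← MonoidHom.map_closure, hT, map_subgroupOf_eq_of_le hH]

/-- If a subgroup is finitely generated modulo the center of a finitely generated group and its
commutator with the whole group is central, then this commutator is finitely generated. -/
theorem fg_commutator_top [Group.FG G] {D : Subgroup G} {T : Finset G}
    (hD : D ≤ closure (T : Set G) ⊔ center G) (hT : (T : Set G) ⊆ D)
    (hc : ⁅D, (⊤ : Subgroup G)⁆ ≤ center G) : (⁅D, (⊤ : Subgroup G)⁆).FG := by
  classical
  obtain ⟨S, hS⟩ := (Group.fg_def (G := G)).mp inferInstance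
  set F : Finset G := (T ×ˢ S).image fun x => ⁅x.1, x.2⁆
  set M : Subgroup G := closure (F : Set G) with hM
  have hMle : M ≤ ⁅D, (⊤ : Subgroup G)⁆ := by
    rw [hM, closure_le]
    intro x hx
    obtain ⟨⟨t, s⟩, hts, rfl⟩ := Finset.mem_image.mp (Finset.mem_coe.mp hx)
    exact commutator_mem_commutator (hT (Finset.mem_product.mp hts).1) (mem_top s)
  have hMn : M.Normal :=
    ⟨fun x hx g => by
      rw [mem_center_iff.mp (hc (hMle hx)) g]
      simpa using hx⟩
  have hmk (t g : G) : ⁅t, g⁆ ∈ M ↔ Commute (t : G ⧸ M) (g : G ⧸ M) := by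
    rw [← QuotientGroup.eq_one_iff, ← commutatorElement_eq_one_iff_commute]
    rfl
  have hT' : closure (T : Set G) ≤ (center (G ⧸ M)).comap (QuotientGroup.mk' M) := by
    rw [closure_le]
    intro t ht
    have hS' : closure (S : Set G) ≤
        (centralizer {(t : G ⧸ M)}).comap (QuotientGroup.mk' M) := by
      rw [closure_le]
      intro s hs
      have h : ⁅t, s⁆ ∈ M :=
        subset_closure (Finset.mem_coe.mpr (Finset.mem_image.mpr
          ⟨(t, s), Finset.mem_product.mpr ⟨ht, hs⟩, rfl⟩))
      simpa [mem_centralizer_iff] using ((hmk t s).mp h).eq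
    rw [hS] at hS'
    refine mem_comap.mpr (mem_center_iff.mpr fun g => ?_)
    obtain ⟨g, rfl⟩ := QuotientGroup.mk_surjective g
    have h := hS' (mem_top g)
    simp only [mem_comap, mem_centralizer_iff, Set.mem_singleton_iff, forall_eq] at h
    exact h.symm
  have hZ : center G ≤ (center (G ⧸ M)).comap (QuotientGroup.mk' M) := by
    intro z hz
    refine mem_comap.mpr (mem_center_iff.mpr fun g => ?_)
    obtain ⟨g, rfl⟩ := QuotientGroup.mk_surjective g
    exact congrArg (QuotientGroup.mk' M) (mem_center_iff.mp hz g)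
  refine ⟨F, le_antisymm hMle (commutator_le.mpr fun d hd g _ => (hmk d g).mpr ?_)⟩
  exact (mem_center_iff.mp (mem_comap.mp ((hD.trans (sup_le hT' hZ)) hd)) (g : G ⧸ M)).symm

/-- Subgroups of finitely generated nilpotent groups are finitely generated. -/
theorem fg_of_isNilpotent [Group.FG G] [Group.IsNilpotent G] (H : Subgroup G) : H.FG := by
  classical
  obtain ⟨n, hn⟩ := nilpotent_iff_lowerCentralSeries.mp (inferInstance : Group.IsNilpotent G)
  induction n generalizing G with
  | zero =>
    have : H = ⊥ := le_bot_iff.mp (hn ▸ le_top)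
    rw [this]
    exact FG.bot
  | succ n ih =>
    set L : Subgroup G := (⊤ : Subgroup G).lowerCentralSeries n with hL
    have hLc : L ≤ center G := by
      intro x hx
      refine mem_center_iff.mpr fun g => ?_
      have h : ⁅x, g⁆ ∈ (⊤ : Subgroup G).lowerCentralSeries (n + 1) :=
        commutator_mem_commutator hx (mem_top g)
      rw [hn, mem_bot] at h
      exact (commutatorElement_eq_one_iff_mul_comm.mp h).symm
    have hQ (K : Subgroup (G ⧸ L)) : K.FG := by
      refine ih K ?_
      rw [← map_top_of_surjective _ (QuotientGroup.mk'_surjective L), ← map_lowerCentralSeries,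
        ← hL, QuotientGroup.map_mk'_self]
    have hLfg : L.FG := by
      cases n with
      | zero => exact (Group.fg_def (G := G)).mp inferInstance
      | succ d =>
        set D := (⊤ : Subgroup G).lowerCentralSeries d
        obtain ⟨T, hT⟩ := hQ (D.map (QuotientGroup.mk' L))
        have hTsub : (T : Set (G ⧸ L)) ⊆ QuotientGroup.mk' L '' (D : Set G) := by
          rw [← coe_map, ← hT]
          exact subset_closure
        obtain ⟨U, hT'D, hT'⟩ := Finset.subset_set_image_iff.mp hTsub
        refine fg_commutator_top (D := D) (T := U) (fun x hx => ?_) hT'D hLc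
        obtain ⟨y, hy, hyx⟩ : QuotientGroup.mk' L x ∈
            (closure (U : Set G)).map (QuotientGroup.mk' L) := by
          rw [MonoidHom.map_closure, ← Finset.coe_image, hT', hT]
          exact mem_map_of_mem _ hx
        have hz : y⁻¹ * x ∈ center G := hLc (QuotientGroup.eq.mp hyx)
        simpa using mul_mem_sup hy hz
    refine fg_of_fg_map_of_fg_inf_ker (QuotientGroup.mk' L) H (hQ _) ?_
    exact hLfg.of_le_of_le_center hLc (by simp)

/-- **Schur's theorem**: a group whose center has finite index has finite commutator subgroup. -/
theorem finite_commutator_of_finite_quotient_center [Finite (G ⧸ center G)] :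
    Finite (_root_.commutator G) := by
  have hout (g : G) : ∃ z ∈ center G, g = (g : G ⧸ center G).out * z :=
    ⟨(g : G ⧸ center G).out⁻¹ * g, QuotientGroup.eq.mp (QuotientGroup.out_eq' _), by simp⟩
  have : Finite (commutatorSet G) := by
    refine (Set.finite_range fun x : (G ⧸ center G) × (G ⧸ center G) =>
      ⁅x.1.out, x.2.out⁆).subset ?_
    rintro _ ⟨g, h, rfl⟩
    refine ⟨(g, h), ?_⟩
    obtain ⟨y, hy, hgy⟩ := hout g
    obtain ⟨z, hz, hhz⟩ := hout h
    have hyc (k : G) : Commute k y := mem_center_iff.mp hy k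
    have hzc (k : G) : Commute k z := mem_center_iff.mp hz k
    conv_rhs => rw [hgy, hhz]
    rw [commutatorElement_mul_left_eq_conj_mul, (hyc _).symm.commutator_eq,
      commutatorElement_mul_right_eq_mul_conj, (hzc _).commutator_eq]
    simp
  infer_instance

end Subgroup

namespace Group

/-- A finitely generated commutative group without homomorphisms onto `ℤ` is finite. -/
theorem finite_of_commGroup_fg_of_forall_not_surjective {A : Type*} [CommGroup A] [Group.FG A]
    (h : ∀ f : A →* Multiplicative ℤ, ¬ Function.Surjective f) : Finite A := by
  classical
  obtain ⟨ι, j, _, _, p, hp, e, ⟨E⟩⟩ := CommGroup.equiv_free_prod_prod_multiplicative_zmod A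
  have hj : IsEmpty j := by
    refine ⟨fun i => h (((Pi.evalMonoidHom _ i).comp (MonoidHom.fst _ _)).comp E.toMonoidHom) ?_⟩
    exact ((Function.surjective_eval i).comp Prod.fst_surjective).comp E.surjective
  have (i : ι) : NeZero (p i ^ e i) := ⟨pow_ne_zero _ (hp i).ne_zero⟩
  have (i : ι) : Finite (Multiplicative (ZMod (p i ^ e i))) :=
    inferInstanceAs (Finite (ZMod (p i ^ e i)))
  exact Finite.of_equiv _ E.symm.toEquiv

/-- A finitely generated nilpotent group without homomorphisms onto `ℤ` is finite. -/
theorem finite_of_isNilpotent_of_fg_of_forall_not_surjective {G : Type*} [Group G]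
    [Group.IsNilpotent G] (hG : Group.FG G)
    (h : ∀ f : G →* Multiplicative ℤ, ¬ Function.Surjective f) : Finite G := by
  revert hG h
  refine nilpotent_center_quotient_ind (P := fun G _ _ => Group.FG G →
    (∀ f : G →* Multiplicative ℤ, ¬ Function.Surjective f) → Finite G) G ?_ ?_
  · intro G _ _ _ _
    infer_instance
  · intro G _ _ ih _ h
    have := ih inferInstance fun f hf =>
      h (f.comp (QuotientGroup.mk' _)) (hf.comp (QuotientGroup.mk'_surjective _))
    have := Subgroup.finite_commutator_of_finite_quotient_center (G := G)
    have hfg : Group.FG (Abelianization G) :=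
      inferInstanceAs (Group.FG (G ⧸ _root_.commutator G))
    have : Finite (Abelianization G) :=
      finite_of_commGroup_fg_of_forall_not_surjective fun f hf =>
        h (f.comp Abelianization.of) (hf.comp (QuotientGroup.mk'_surjective _))
    have : Finite (G ⧸ _root_.commutator G) := this
    exact Finite.of_subgroup_quotient (_root_.commutator G)

end Group

/-- A nontrivial finite `p`-group has a normal subgroup of index `p`. -/
theorem IsPGroup.exists_normal_index_eq {p : ℕ} [hp : Fact p.Prime] {P : Type*} [Group P]
    [Finite P] [Nontrivial P] (hP : IsPGroup p P) :
    ∃ K : Subgroup P, K.Normal ∧ K.index = p := by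
  obtain ⟨n, hn, hcard⟩ := hP.nontrivial_iff_card.mp inferInstance
  obtain ⟨m, rfl⟩ := Nat.exists_eq_succ_of_ne_zero hn.ne'
  obtain ⟨K, hK⟩ := Sylow.exists_subgroup_card_pow_prime (G := P) p (n := m)
    (hcard ▸ pow_dvd_pow p m.le_succ)
  have hidx : K.index = p := by
    have h := K.card_mul_index
    rw [hK, hcard, pow_succ] at h
    exact Nat.eq_of_mul_eq_mul_left (pow_pos hp.out.pos m) h
  refine ⟨K, Subgroup.normal_of_index_eq_minFac_card ?_, hidx⟩
  rw [hidx, hcard, hp.out.pow_minFac m.succ_ne_zero]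

/-- A finite nilpotent group of order divisible by a prime `p` maps onto every group of
order `p`. -/
theorem Group.exists_surjective_of_isNilpotent_of_dvd_card {H C : Type*} [Group H] [Group C]
    [Finite H] [Group.IsNilpotent H] {p : ℕ} [hp : Fact p.Prime] (hdvd : p ∣ Nat.card H)
    (hC : Nat.card C = p) : ∃ f : H →* C, Function.Surjective f := by
  classical
  obtain ⟨E⟩ := ((Group.isNilpotent_of_finite_tfae (G := H)).out 0 4).mp ‹Group.IsNilpotent H›
  let P : Sylow p H := default
  have hpP : p ∣ Nat.card P := P.dvd_card_of_dvd_card hdvd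
  have : Nontrivial P := by
    rw [← Finite.one_lt_card_iff_nontrivial]
    exact hp.out.one_lt.trans_le (Nat.le_of_dvd Nat.card_pos hpP)
  obtain ⟨K, hKn, hK⟩ := P.isPGroup'.exists_normal_index_eq
  let i : (Nat.card H).primeFactors :=
    ⟨p, Nat.mem_primeFactors.mpr ⟨hp.out, hdvd, Nat.card_pos.ne'⟩⟩
  let e : P ⧸ K ≃* C := mulEquivOfPrimeCardEq (p := p) hK hC
  let ev : (∀ q : (Nat.card H).primeFactors, ∀ Q : Sylow q H, (↑Q : Subgroup H)) →* P :=
    (Pi.evalMonoidHom (fun Q : Sylow p H => (↑Q : Subgroup H)) P).comp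
      (Pi.evalMonoidHom (fun q : (Nat.card H).primeFactors =>
        ∀ Q : Sylow q H, (↑Q : Subgroup H)) i)
  refine ⟨((e.toMonoidHom.comp (QuotientGroup.mk' K)).comp ev).comp E.symm.toMonoidHom, ?_⟩
  have hev : Function.Surjective ev :=
    (Function.surjective_eval P).comp (Function.surjective_eval i)
  exact ((e.surjective.comp (QuotientGroup.mk'_surjective K)).comp hev).comp E.symm.surjective

namespace MonoidHom

variable {X G : Type*} [Group X] [Group G] {a : X →* G}

theorem ker_le_center_of_injective_comp
    (ha : Function.Injective fun f : X →* X => a.comp f) : a.ker ≤ Subgroup.center X := by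
  intro n hn
  have hconj : (MulAut.conj n).toMonoidHom = MonoidHom.id X := by
    refine ha (MonoidHom.ext fun x => ?_)
    simp [mem_ker.mp hn]
  refine Subgroup.mem_center_iff.mpr fun g => ?_
  have h : n * g * n⁻¹ = g := by simpa using DFunLike.congr_fun hconj g
  exact (mul_inv_eq_iff_eq_mul.mp h).symm

theorem eq_one_of_injective_comp (ha : Function.Injective fun f : X →* X => a.comp f)
    (φ : X →* X) (hφ : ∀ x, φ x ∈ a.ker) : φ = 1 :=
  ha (MonoidHom.ext fun x => by simpa using hφ x)

theorem injective_of_injective_comp [Group.FG G] [Group.IsNilpotent G]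
    (ha : Function.Injective fun f : X →* X => a.comp f) : Function.Injective a := by
  rw [injective_iff_map_eq_one]
  by_contra! hne
  obtain ⟨n, hn, hn1⟩ := hne
  have hker := ker_le_center_of_injective_comp ha
  have hfg : Group.FG a.range :=
    (Group.fg_iff_subgroup_fg _).mpr (Subgroup.fg_of_isNilpotent a.range)
  have hfin : Finite a.range := by
    refine Group.finite_of_isNilpotent_of_fg_of_forall_not_surjective hfg fun f hf => ?_
    have h1 := eq_one_of_injective_comp ha
      ((zpowersHom X n).comp (f.comp a.rangeRestrict)) fun x => by
        simp [mem_ker, hn]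
    obtain ⟨x, hx⟩ := (hf.comp a.rangeRestrict_surjective) (Multiplicative.ofAdd 1)
    have h2 := DFunLike.congr_fun h1 x
    simp only [Function.comp_apply] at hx
    simp [hx] at h2
    exact hn1 h2
  have hidx : a.ker.index = Nat.card a.range := Subgroup.index_ker a
  have hkf : a.ker.FiniteIndex := ⟨by rw [hidx]; exact Nat.card_pos.ne'⟩
  have hzf : (Subgroup.center X).FiniteIndex := Subgroup.finiteIndex_of_le hker
  have hzdvd : (Subgroup.center X).index ∣ Nat.card a.range :=
    hidx ▸ Subgroup.index_dvd_of_le hker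
  have hmul (x y : X) : ((x * y) ^ (Subgroup.center X).index) ^ Nat.card a.range =
      (x ^ (Subgroup.center X).index) ^ Nat.card a.range *
        (y ^ (Subgroup.center X).index) ^ Nat.card a.range := by
    have h : Commute (x ^ (Subgroup.center X).index) (y ^ (Subgroup.center X).index) := by
      rw [← transferCenterPow_apply y]
      exact Subgroup.mem_center_iff.mp (SetLike.coe_mem _) _
    rw [← h.mul_pow]
    simp only [← transferCenterPow_apply, map_mul, Subgroup.coe_mul]
  have hexp (x : X) : (x ^ (Subgroup.center X).index) ^ Nat.card a.range = 1 := by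
    let φ : X →* X :=
      MonoidHom.mk' (fun x => (x ^ (Subgroup.center X).index) ^ Nat.card a.range) hmul
    refine DFunLike.congr_fun (eq_one_of_injective_comp ha φ fun x => ?_) x
    have h : (a.rangeRestrict (x ^ (Subgroup.center X).index)) ^ Nat.card a.range = 1 :=
      pow_card_eq_one'
    rw [← map_pow] at h
    exact congrArg Subtype.val h
  obtain ⟨p, hp, hpn⟩ := Nat.exists_prime_and_dvd (mt orderOf_eq_one_iff.mp hn1)
  have : Fact p.Prime := ⟨hp⟩
  have hord : orderOf n ∣ (Subgroup.center X).index * Nat.card a.range :=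
    orderOf_dvd_of_pow_eq_one (by rw [pow_mul, hexp])
  have hdvd : p ∣ Nat.card a.range := by
    rcases hp.dvd_mul.mp (hpn.trans hord) with h | h
    exacts [h.trans hzdvd, h]
  have hn0 : orderOf n ≠ 0 :=
    ne_zero_of_dvd_ne_zero (mul_ne_zero hzf.index_ne_zero Nat.card_pos.ne') hord
  set m := n ^ (orderOf n / p) with hm
  have hmp : orderOf m = p := orderOf_pow_orderOf_div hn0 hpn
  obtain ⟨f, hf⟩ := Group.exists_surjective_of_isNilpotent_of_dvd_card
    (C := Subgroup.zpowers m) hdvd ((Nat.card_zpowers m).trans hmp)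
  have hmker : Subgroup.zpowers m ≤ a.ker :=
    Subgroup.zpowers_le.mpr (a.ker.pow_mem hn _)
  have h1 := eq_one_of_injective_comp ha
    ((Subgroup.zpowers m).subtype.comp (f.comp a.rangeRestrict)) fun x => hmker (SetLike.coe_mem _)
  obtain ⟨x, hx⟩ := (hf.comp a.rangeRestrict_surjective) ⟨m, Subgroup.mem_zpowers m⟩
  have hm1 : m = 1 := by
    have h2 := DFunLike.congr_fun h1 x
    have h3 := congrArg Subtype.val hx
    exact h3.symm.trans h2
  rw [hm1, orderOf_one] at hmp
  exact hp.one_lt.ne hmp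

end MonoidHom


/-- Let `a : X → G` be a generalized subgroup with `G` finitely
generated and nilpotent. Then `a` is injective; in particular `X` is isomorphic to a
subgroup of `G` and hence is itself finitely generated and nilpotent. -/
theorem stmt13 {X G : Type*} [Group X] [Group G] [Group.FG G] [Group.IsNilpotent G]
    (a : X →* G) (ha : Function.Injective (fun f : X →* X => a.comp f)) :
    Function.Injective a ∧ Nonempty (X ≃* a.range) ∧
      Group.FG X ∧ Group.IsNilpotent X := by
  have hinj := MonoidHom.injective_of_injective_comp ha
  have e : X ≃* a.range := MonoidHom.ofInjective hinj
  have : Group.FG a.range :=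
    (Group.fg_iff_subgroup_fg _).mpr (Subgroup.fg_of_isNilpotent a.range)
  exact ⟨hinj, ⟨e⟩, Group.fg_of_surjective (f := e.symm.toMonoidHom) e.symm.surjective,
    Group.nilpotent_of_mulEquiv e.symm⟩
end

section
/- Let A be a finite abelian group. For every positive integer k, the inclusion into A of the k-torsion subgroup {a ∈ A : a^k = 1} is a cellular cover of A. Conversely, if X is a subgroup of A whose inclusion X ↪ A is a cellular cover, then X is the k-torsion subgroup of A, where k is the exponent of X. -/
/-- The `k`-torsion subgroup `{a ∈ A | a ^ k = 1}` of a commutative group `A`. -/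
def kTorsion (A : Type*) [CommGroup A] (k : ℕ) : Subgroup A where
  carrier := {a : A | a ^ k = 1}
  one_mem' := one_pow k
  mul_mem' := by
    intro a b ha hb
    simp only [Set.mem_setOf_eq] at *
    rw [mul_pow, ha, hb, mul_one]
  inv_mem' := by
    intro a ha
    simp only [Set.mem_setOf_eq] at *
    rw [inv_pow, ha, inv_one]

/-- If the exponent of a finite abelian group `G` annihilates an element `a` of a group `H`, then
`a` lies in the image of some homomorphism `G →* H`. -/
theorem exists_monoidHom_apply_eq_of_pow_exponent_eq_one {G H : Type*} [CommGroup G] [Finite G]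
    [Group H] {a : H} (ha : a ^ Monoid.exponent G = 1) : ∃ (f : G →* H) (x : G), f x = a := by
  have : NeZero (Monoid.exponent G) := ⟨Monoid.exponent_ne_zero_of_finite⟩
  obtain ⟨φ⟩ := CommGroup.monoidHom_mulEquiv_of_hasEnoughRootsOfUnity G ℂ
  have : Finite (G →* ℂˣ) := Finite.of_equiv G φ.symm.toEquiv
  obtain ⟨χ, hχ⟩ := Monoid.exists_orderOf_eq_exponent
    (Monoid.ExponentExists.of_finite (G := G →* ℂˣ))
  rw [Monoid.exponent_eq_of_mulEquiv φ] at hχ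
  have : Finite χ.range := Finite.of_surjective _ χ.rangeRestrict_surjective
  obtain ⟨g, hg⟩ := IsCyclic.exists_generator (α := χ.range)
  have hdvd : Monoid.exponent G ∣ Nat.card χ.range := by
    rw [← hχ]
    apply orderOf_dvd_of_pow_eq_one
    ext1 x
    exact congrArg Subtype.val (pow_card_eq_one' (x := χ.rangeRestrict x))
  have hord : orderOf a ∣ orderOf g := by
    rw [orderOf_eq_card_of_forall_mem_zpowers hg]
    exact (orderOf_dvd_of_pow_eq_one ha).trans hdvd
  obtain ⟨x, hx⟩ := χ.rangeRestrict_surjective g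
  refine ⟨(monoidHomOfForallMemZpowers hg hord).comp χ.rangeRestrict, x, ?_⟩
  rw [MonoidHom.comp_apply, hx, monoidHomOfForallMemZpowers_apply_gen]

/-- Let `A` be a finite abelian group. For every positive integer
`k`, the inclusion of the `k`-torsion subgroup of `A` is a cellular cover of `A`.
Conversely, if the inclusion of a subgroup `X ≤ A` is a cellular cover, then `X` is
the `k`-torsion subgroup of `A` where `k` is the exponent of `X`. -/
theorem stmt14 {A : Type*} [CommGroup A] [Finite A] :
    (∀ k : ℕ, 0 < k →
      Function.Bijective
        (fun f : kTorsion A k →* kTorsion A k => (kTorsion A k).subtype.comp f)) ∧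
    (∀ X : Subgroup A,
      Function.Bijective (fun f : X →* X => X.subtype.comp f) →
      X = kTorsion A (Monoid.exponent X)) := by
  have hinj : ∀ Y : Subgroup A, Function.Injective (fun f : Y →* Y => Y.subtype.comp f) :=
    fun Y f g h => MonoidHom.ext fun x => Subtype.ext (DFunLike.congr_fun h x)
  refine ⟨fun k _ => ⟨hinj _, fun g => ?_⟩, fun X hX => le_antisymm ?_ ?_⟩
  · refine ⟨g.codRestrict (kTorsion A k) fun x => ?_, rfl⟩
    change g x ^ k = 1
    have hx : x ^ k = 1 := Subtype.ext x.2
    rw [← map_pow, hx, map_one]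
  · intro x hx
    exact congrArg Subtype.val (Monoid.pow_exponent_eq_one (⟨x, hx⟩ : X))
  · intro a ha
    obtain ⟨f, x, rfl⟩ := exists_monoidHom_apply_eq_of_pow_exponent_eq_one (G := X) ha
    obtain ⟨h, rfl⟩ := hX.2 f
    exact (h x).2
end

section
/- Let I be a finite group and a : X → I a surjective generalized subgroup of I. Then: (1) the induced homomorphism on abelianizations X_ab → I_ab (sending x[X,X] to a(x)[I,I]) is an isomorphism; and (2) if Y is a subgroup of X with a(Y) = I, then Y = X. -/
/-- A nonzero element of an additive group of exponent `p` is detected by some homomorphism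
to `ℤ/p`. -/
theorem AddCommGroup.exists_hom_zmod_ne_zero {V : Type*} [AddCommGroup V] {p : ℕ} (hp : p.Prime)
    (hV : ∀ v : V, p • v = 0) {v : V} (hv : v ≠ 0) : ∃ φ : V →+ ZMod p, φ v ≠ 0 := by
  have := Fact.mk hp
  have _ : Module (ZMod p) V := AddCommGroup.zmodModule hV
  obtain ⟨φ, hφ⟩ := Module.Projective.exists_dual_ne_zero (ZMod p) hv
  exact ⟨φ.toAddMonoidHom, hφ⟩

/-- An element of an abelian group that is not a `p`-th power is detected by some homomorphism
to `ℤ/p`. -/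
theorem CommGroup.exists_hom_zmod_ne_one {A : Type*} [CommGroup A] {p : ℕ} (hp : p.Prime)
    {w : A} (hw : ∀ v : A, v ^ p ≠ w) :
    ∃ f : A →* Multiplicative (ZMod p), f w ≠ 1 := by
  let H : Subgroup A := (powMonoidHom p : A →* A).range
  have hne : Additive.ofMul (w : A ⧸ H) ≠ 0 := fun h => by
    obtain ⟨v, hv⟩ := (QuotientGroup.eq_one_iff w).1 (Additive.ofMul.injective h)
    exact hw v hv
  obtain ⟨φ, hφ⟩ := AddCommGroup.exists_hom_zmod_ne_zero hp (fun b => by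
    obtain ⟨c, hc⟩ := QuotientGroup.mk_surjective b.toMul
    rw [← ofMul_toMul b, ← hc, ← ofMul_pow, ← QuotientGroup.mk_pow]
    exact congrArg Additive.ofMul ((QuotientGroup.eq_one_iff (c ^ p)).2 ⟨c, rfl⟩)) hne
  exact ⟨(AddMonoidHom.toMultiplicativeRight φ).comp (QuotientGroup.mk' H), hφ⟩

/-- An element of order `p` determines an embedding of `ℤ/p`. -/
theorem exists_injective_zmod_hom_of_orderOf_eq {G : Type*} [Group G] {p : ℕ} {z : G}
    (hz : orderOf z = p) :
    ∃ g : Multiplicative (ZMod p) →* G, Function.Injective g ∧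
      ∀ t, g t ∈ Subgroup.zpowers z := by
  let g : ZMod p →+ Additive G := ZMod.lift p ⟨zmultiplesHom (Additive G) (Additive.ofMul z), by
    simp [← ofMul_pow, orderOf_dvd_iff_pow_eq_one.1 hz.dvd]⟩
  have hg : ∀ n : ℤ, AddMonoidHom.toMultiplicativeLeft g (Multiplicative.ofAdd (n : ZMod p)) =
      z ^ n := fun n => by
    change (g n).toMul = z ^ n
    simp [g]
  have hsurj : ∀ t : Multiplicative (ZMod p), ∃ n : ℤ, Multiplicative.ofAdd (n : ZMod p) = t :=
    fun t => ZMod.intCast_surjective t.toAdd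
  refine ⟨AddMonoidHom.toMultiplicativeLeft g, (injective_iff_map_eq_one _).2 fun t ht => ?_,
    fun t => ?_⟩
  · obtain ⟨n, rfl⟩ := hsurj t
    rw [hg, ← orderOf_dvd_iff_zpow_eq_one, hz] at ht
    rw [(ZMod.intCast_zmod_eq_zero_iff_dvd n p).2 ht, ofAdd_zero]
  · obtain ⟨n, rfl⟩ := hsurj t
    exact ⟨n, (hg n).symm⟩

theorem Abelianization.of_surjective {G : Type*} [Group G] :
    Function.Surjective (Abelianization.of : G →* Abelianization G) :=
  QuotientGroup.mk_surjective

open scoped commutatorElement in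
/-- A subgroup that together with the center generates the group contains the derived subgroup. -/
theorem commutator_le_of_forall_exists_mul_center {G : Type*} [Group G] {Y : Subgroup G}
    (hY : ∀ g, ∃ y ∈ Y, ∃ k ∈ Subgroup.center G, g = y * k) : commutator G ≤ Y := by
  rw [commutator_def, Subgroup.commutator_le]
  intro g₁ _ g₂ _
  obtain ⟨y₁, hy₁, k₁, hk₁, rfl⟩ := hY g₁
  obtain ⟨y₂, hy₂, k₂, hk₂, rfl⟩ := hY g₂
  have h₁ := Subgroup.mem_center_iff.1 hk₁
  have h₂ := Subgroup.mem_center_iff.1 hk₂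
  have h : ⁅y₁ * k₁, y₂ * k₂⁆ = ⁅y₁, y₂⁆ := by
    simp only [commutatorElement_def, mul_inv_rev]
    calc y₁ * k₁ * (y₂ * k₂) * (k₁⁻¹ * y₁⁻¹) * (k₂⁻¹ * y₂⁻¹)
        = y₁ * (k₁ * (y₂ * k₂)) * k₁⁻¹ * y₁⁻¹ * k₂⁻¹ * y₂⁻¹ := by group
      _ = y₁ * y₂ * (k₂ * y₁⁻¹) * k₂⁻¹ * y₂⁻¹ := by rw [← h₁]; group
      _ = y₁ * y₂ * y₁⁻¹ * y₂⁻¹ := by rw [← h₂]; group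
  rw [h, commutatorElement_def]
  exact Y.mul_mem (Y.mul_mem (Y.mul_mem hy₁ hy₂) (Y.inv_mem hy₁)) (Y.inv_mem hy₂)

section GeneralizedSubgroup

variable {X I : Type*} [Group X] [Group I] {a : X →* I}

theorem ker_le_center_of_comp_injective
    (hgen : Function.Injective (fun f : X →* X => a.comp f)) :
    a.ker ≤ Subgroup.center X := by
  intro k hk
  rw [Subgroup.mem_center_iff]
  intro g
  have h : (MulAut.conj k).toMonoidHom = MonoidHom.id X := hgen <| by
    ext x
    simp [MonoidHom.mem_ker.1 hk]
  have := DFunLike.congr_fun h g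
  simp only [MulEquiv.toMonoidHom_eq_coe, MonoidHom.coe_coe, MulAut.conj_apply,
    MonoidHom.id_apply] at this
  exact (mul_inv_eq_iff_eq_mul.1 this).symm

theorem eq_one_of_range_le_ker
    (hgen : Function.Injective (fun f : X →* X => a.comp f))
    (f : X →* X) (hf : ∀ x, f x ∈ a.ker) (x : X) : f x = 1 := by
  have hc : ∀ y g, g * f y = f y * g := fun y g =>
    Subgroup.mem_center_iff.1 (ker_le_center_of_comp_injective hgen (hf y)) g
  let F : X →* X :=
    { toFun := fun y => y * f y
      map_one' := by simp
      map_mul' := fun y z => by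
        rw [map_mul, mul_assoc, mul_assoc, ← mul_assoc z, hc y z, mul_assoc] }
  have h : F = MonoidHom.id X := hgen <| by
    ext y
    change a (y * f y) = a y
    rw [map_mul, MonoidHom.mem_ker.1 (hf y), mul_one]
  exact mul_eq_left.1 (DFunLike.congr_fun h x)

/-- The domain of a generalized subgroup of a finite group has finite exponent, because
the transfer to the center is a power map. -/
theorem exists_pow_eq_one_of_comp_injective [Finite I]
    (hgen : Function.Injective (fun f : X →* X => a.comp f)) :
    ∃ N ≠ 0, ∀ x : X, x ^ N = 1 := by
  have hZ : (Subgroup.center X).FiniteIndex :=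
    Subgroup.finiteIndex_of_le (ker_le_center_of_comp_injective hgen)
  refine ⟨(Subgroup.center X).index * Nat.card I,
    mul_ne_zero hZ.index_ne_zero Nat.card_pos.ne', fun x => ?_⟩
  let f : X →* X :=
    { toFun := fun y => y ^ ((Subgroup.center X).index * Nat.card I)
      map_one' := one_pow _
      map_mul' := fun y z => by
        have h : (y * z) ^ (Subgroup.center X).index =
            y ^ (Subgroup.center X).index * z ^ (Subgroup.center X).index :=
          congrArg Subtype.val (map_mul (MonoidHom.transferCenterPow X) y z)
        have hc : Commute (y ^ (Subgroup.center X).index) (z ^ (Subgroup.center X).index) :=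
          Subgroup.mem_center_iff.1 (MonoidHom.transferCenterPow X z).2 _
        rw [pow_mul, h, hc.mul_pow, ← pow_mul, ← pow_mul] }
  refine eq_one_of_range_le_ker hgen f (fun y => ?_) x
  change y ^ ((Subgroup.center X).index * Nat.card I) ∈ a.ker
  rw [MonoidHom.mem_ker, map_pow, pow_mul, pow_card_eq_one']

theorem ker_le_commutator_of_comp_injective [Finite I]
    (hgen : Function.Injective (fun f : X →* X => a.comp f)) :
    a.ker ≤ commutator X := by
  intro k hk
  by_contra hkc
  obtain ⟨N, hN, hexp⟩ := exists_pow_eq_one_of_comp_injective hgen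
  have hexpA : ∀ b : Abelianization X, b ^ N = 1 := fun b => by
    obtain ⟨x, rfl⟩ := Abelianization.of_surjective b
    rw [← map_pow, hexp, map_one]
  set b : Abelianization X := Abelianization.of k
  have hb1 : orderOf b ≠ 1 := fun h => hkc <| by
    rw [← Abelianization.ker_of]
    exact orderOf_eq_one_iff.1 h
  obtain ⟨p, hp, hpb⟩ := Nat.exists_prime_and_dvd hb1
  have hk0 : orderOf k ≠ 0 :=
    (orderOf_pos_iff.2 (isOfFinOrder_iff_pow_eq_one.2 ⟨N, Nat.pos_of_ne_zero hN, hexp k⟩)).ne'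
  have hpk : p ∣ orderOf k := hpb.trans (orderOf_map_dvd _ _)
  have hz : orderOf (k ^ (orderOf k / p)) = p := orderOf_pow_orderOf_div hk0 hpk
  obtain ⟨w, hw⟩ : ∃ w : Abelianization X, ∀ v, v ^ p ≠ w := by
    by_contra! hdiv
    have hdiv' : ∀ e : ℕ, ∀ w : Abelianization X, ∃ v, v ^ p ^ e = w := by
      intro e
      induction e with
      | zero => exact fun w => ⟨w, by simp⟩
      | succ e ih =>
        intro w
        obtain ⟨v, rfl⟩ := hdiv w
        obtain ⟨u, rfl⟩ := ih v
        exact ⟨u, by rw [pow_succ, pow_mul]⟩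
    obtain ⟨e, m, hm, hNm⟩ := Nat.exists_eq_pow_mul_and_not_dvd hN p hp.ne_one
    obtain ⟨v, hv⟩ := hdiv' e b
    refine hm (hpb.trans (orderOf_dvd_of_pow_eq_one ?_))
    rw [← hv, ← pow_mul, ← hNm, hexpA]
  obtain ⟨φ, hφ⟩ := CommGroup.exists_hom_zmod_ne_one hp hw
  obtain ⟨x, rfl⟩ := Abelianization.of_surjective w
  obtain ⟨g, hg, hgz⟩ := exists_injective_zmod_hom_of_orderOf_eq hz
  refine hφ (hg ?_)
  rw [map_one]
  exact eq_one_of_range_le_ker hgen (g.comp (φ.comp Abelianization.of))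
    (fun y => (Subgroup.zpowers_le.2 (a.ker.pow_mem hk _)) (hgz _)) x

end GeneralizedSubgroup

/-- Let `I` be a finite group and `a : X → I` a surjective
generalized subgroup of `I`. Then (1) the induced homomorphism on abelianizations
`X_ab → I_ab` is an isomorphism (a bijection), and (2) any subgroup `Y ≤ X` with
`a(Y) = I` equals `X`. -/
theorem stmt15 {X I : Type*} [Group X] [Group I] [Finite I] (a : X →* I)
    (hsurj : Function.Surjective a)
    (hgen : Function.Injective (fun f : X →* X => a.comp f)) :
    Function.Bijective (Abelianization.map a) ∧
    (∀ Y : Subgroup X, Y.map a = ⊤ → Y = ⊤) := by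
  have hker := ker_le_commutator_of_comp_injective hgen
  refine ⟨⟨(injective_iff_map_eq_one _).2 fun b hb => ?_, fun c => ?_⟩, fun Y hY => ?_⟩
  · obtain ⟨x, rfl⟩ := Abelianization.of_surjective b
    rw [Abelianization.map_of, ← MonoidHom.mem_ker, Abelianization.ker_of, commutator_def,
      ← Subgroup.map_top_of_surjective a hsurj, ← Subgroup.map_commutator] at hb
    obtain ⟨y, hy, hyx⟩ := hb
    rw [← MonoidHom.mem_ker, Abelianization.ker_of]
    have hxy : y⁻¹ * x ∈ commutator X := hker (by simp [MonoidHom.mem_ker, hyx])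
    simpa using (commutator X).mul_mem hy hxy
  · obtain ⟨i, rfl⟩ := Abelianization.of_surjective c
    obtain ⟨x, rfl⟩ := hsurj i
    exact ⟨Abelianization.of x, Abelianization.map_of a x⟩
  · have hdec : ∀ x, ∃ y ∈ Y, ∃ k ∈ a.ker, x = y * k := fun x => by
      obtain ⟨y, hy, hyx⟩ : a x ∈ Y.map a := hY ▸ Subgroup.mem_top _
      exact ⟨y, hy, y⁻¹ * x, by simp [MonoidHom.mem_ker, hyx], by simp⟩
    have hcomm : commutator X ≤ Y := commutator_le_of_forall_exists_mul_center fun x => by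
      obtain ⟨y, hy, k, hk, h⟩ := hdec x
      exact ⟨y, hy, k, ker_le_center_of_comp_injective hgen hk, h⟩
    refine (Subgroup.eq_top_iff' Y).2 fun x => ?_
    obtain ⟨y, hy, k, hk, rfl⟩ := hdec x
    exact Y.mul_mem hy (hcomm (hker hk))
end

section
/- Let G be a finite simple group and c : X → G a surjective generalized subgroup of G. Then every nontrivial group homomorphism f : X → G can be expressed as f = h ∘ c for some automorphism h : G → G. -/
/-- Complex characters of a finite commutative group detect nontrivial elements. -/
theorem exists_monoidHom_units_complex_ne_one {H : Type*} [Group H] [Finite H]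
    (hcomm : ∀ a b : H, a * b = b * a) {a : H} (ha : a ≠ 1) :
    ∃ φ : H →* ℂˣ, φ a ≠ 1 := by
  let _ : CommGroup H := { (inferInstance : Group H) with mul_comm := hcomm }
  have : NeZero (Monoid.exponent H) := ⟨Monoid.exponent_ne_zero_of_finite⟩
  exact CommGroup.exists_apply_ne_one_of_hasEnoughRootsOfUnity H ℂ ha

/-- If a nontrivial homomorphism `f` to a finite group maps the torsion central subgroup `K`
onto its whole range, then `K` contains the range of a nontrivial endomorphism. -/
theorem exists_ne_one_forall_mem_of_map_eq_range {X G : Type*} [Group X] [Group G] [Finite G]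
    {K : Subgroup X} (hK : K ≤ Subgroup.center X) (htors : ∀ k ∈ K, IsOfFinOrder k)
    {f : X →* G} (hf : f ≠ 1) (hrange : K.map f = f.range) :
    ∃ e : X →* X, e ≠ 1 ∧ ∀ x, e x ∈ K := by
  obtain ⟨x₀, hx₀⟩ : ∃ x, f x ≠ 1 := by
    by_contra! h
    exact hf (MonoidHom.ext h)
  have hlift : ∀ x, ∃ k ∈ K, f k = f x := fun x =>
    Subgroup.mem_map.mp (hrange ▸ MonoidHom.mem_range.mpr ⟨x, rfl⟩)
  have hcomm : ∀ a b : f.range, a * b = b * a := by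
    rintro ⟨_, x, rfl⟩ ⟨_, y, rfl⟩
    obtain ⟨k, hk, hkx⟩ := hlift x
    ext
    change f x * f y = f y * f x
    rw [← hkx, ← map_mul, ← map_mul, Subgroup.mem_center_iff.mp (hK hk) y]
  obtain ⟨φ, hφ⟩ := exists_monoidHom_units_complex_ne_one hcomm
    (a := f.rangeRestrict x₀) (fun h => hx₀ (congrArg Subtype.val h))
  let ψ : X →* φ.range := φ.rangeRestrict.comp f.rangeRestrict
  have : Finite φ.range := Finite.of_surjective _ φ.rangeRestrict_surjective
  have : IsCyclic φ.range := isCyclic_subgroup_units φ.range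
  obtain ⟨g, hg⟩ := IsCyclic.exists_generator (α := φ.range)
  obtain ⟨x, rfl⟩ : ∃ x, ψ x = g :=
    (φ.rangeRestrict_surjective.comp f.rangeRestrict_surjective) g
  obtain ⟨k, hk, hkx⟩ := hlift x
  have hψ : ψ k = ψ x := congrArg φ.rangeRestrict (Subtype.ext hkx)
  obtain ⟨m, hm⟩ : orderOf (ψ x) ∣ orderOf k := hψ ▸ orderOf_map_dvd ψ k
  have hpos : 0 < orderOf k := (htors k hk).orderOf_pos
  have hm₀ : m ≠ 0 := by
    rintro rfl
    omega
  have horder : orderOf (k ^ m) = orderOf (ψ x) := by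
    rw [orderOf_pow_of_dvd hm₀ ⟨_, hm.trans (mul_comm _ _)⟩, hm,
      Nat.mul_div_cancel _ (Nat.pos_of_ne_zero hm₀)]
  let ι : φ.range →* X := monoidHomOfForallMemZpowers hg horder.dvd
  have hι : ι (ψ x) = k ^ m := monoidHomOfForallMemZpowers_apply_gen hg horder.dvd
  refine ⟨ι.comp ψ, fun h => hφ ?_, fun y => ?_⟩
  · have h₁ : k ^ m = 1 := hι ▸ DFunLike.congr_fun h x
    have h₂ : ψ x = 1 := by rw [← orderOf_eq_one_iff, ← horder, h₁, orderOf_one]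
    obtain ⟨n, hn⟩ := Subgroup.mem_zpowers_iff.mp (hg (ψ x₀))
    rw [h₂, one_zpow] at hn
    exact (congrArg Subtype.val hn).symm
  · obtain ⟨n, hn⟩ := Subgroup.mem_zpowers_iff.mp (hg (ψ y))
    rw [MonoidHom.comp_apply, ← hn, map_zpow, hι]
    exact K.zpow_mem (K.pow_mem hk m) n

/-- The kernel of a generalized subgroup is central. -/
theorem ker_le_center_of_injective_comp {X G : Type*} [Group X] [Group G] {c : X →* G}
    (hgen : Function.Injective (fun f : X →* X => c.comp f)) :
    c.ker ≤ Subgroup.center X := by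
  intro k hk
  have h : (MulAut.conj k).toMonoidHom = MonoidHom.id X := hgen <| by
    ext x
    simp [MonoidHom.mem_ker.mp hk]
  refine Subgroup.mem_center_iff.mpr fun x => ?_
  have hx : k * x * k⁻¹ = x := DFunLike.congr_fun h x
  exact (mul_inv_eq_iff_eq_mul.mp hx).symm

/-- An endomorphism with values in the kernel of a generalized subgroup is trivial. -/
theorem eq_one_of_injective_comp {X G : Type*} [Group X] [Group G] {c : X →* G}
    (hgen : Function.Injective (fun f : X →* X => c.comp f)) {e : X →* X}
    (he : ∀ x, e x ∈ c.ker) : e = 1 :=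
  hgen <| by
    ext x
    simpa using he x

/-- A generalized subgroup of a finite group is torsion. -/
theorem isOfFinOrder_of_injective_comp {X G : Type*} [Group X] [Group G] [Finite G] {c : X →* G}
    (hgen : Function.Injective (fun f : X →* X => c.comp f)) (x : X) : IsOfFinOrder x := by
  have : (Subgroup.center X).FiniteIndex :=
    Subgroup.finiteIndex_of_le (ker_le_center_of_injective_comp hgen)
  let t := MonoidHom.transferCenterPow X
  let e : X →* X := MonoidHom.mk' (fun y => (t y : X) ^ Nat.card G) fun y z => by
    have hcomm : Commute (t y : X) (t z : X) := (Subgroup.mem_center_iff.mp (t z).2 _)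
    rw [map_mul, Subgroup.coe_mul, hcomm.mul_pow]
  have he : e = 1 := eq_one_of_injective_comp hgen fun y => by
    simp [e, MonoidHom.mem_ker]
  have hx : (x ^ (Subgroup.center X).index) ^ Nat.card G = 1 := DFunLike.congr_fun he x
  rw [← pow_mul] at hx
  exact isOfFinOrder_iff_pow_eq_one.mpr
    ⟨_, Nat.mul_pos (Nat.pos_of_ne_zero Subgroup.FiniteIndex.index_ne_zero) Nat.card_pos, hx⟩

/-- A homomorphism from a group `X` to a finite group `G` whose kernel lies in the kernel of
a surjection `c : X →* G` has the same kernel as `c`. -/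
theorem ker_le_ker_of_surjective {X G : Type*} [Group X] [Group G] [Finite G]
    {c f : X →* G} (hsurj : Function.Surjective c) (h : f.ker ≤ c.ker) : c.ker ≤ f.ker := by
  rcases h.eq_or_lt with heq | hlt
  · exact heq.ge
  · have hindex := Subgroup.index_strictAnti hlt
    rw [Subgroup.index_ker, Subgroup.index_ker, MonoidHom.range_eq_top.mpr hsurj,
      Subgroup.card_top] at hindex
    exact absurd (Subgroup.card_le_card_group f.range) hindex.not_ge

/-- Let `G` be a finite simple group and `c : X → G` a surjective
generalized subgroup of `G`. Then every nontrivial homomorphism `f : X → G` can be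
expressed as `f = h ∘ c` for some automorphism `h` of `G`. -/
theorem stmt18 {X G : Type*} [Group X] [Group G] [Finite G] [IsSimpleGroup G]
    (c : X →* G) (hsurj : Function.Surjective c)
    (hgen : Function.Injective (fun f : X →* X => c.comp f))
    (f : X →* G) (hf : f ≠ 1) :
    ∃ h : G ≃* G, f = (h : G →* G).comp c := by
  have hker : c.ker ≤ f.ker := by
    rcases (f.normal_ker.map c hsurj).eq_bot_or_eq_top with hbot | htop
    · exact ker_le_ker_of_surjective hsurj ((Subgroup.map_eq_bot_iff _).mp hbot)
    · have hrange : c.ker.map f = f.range := by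
        refine le_antisymm (Subgroup.map_le_range _ _) ?_
        rintro _ ⟨x, rfl⟩
        obtain ⟨n, hn, hnx⟩ := Subgroup.mem_map.mp (htop ▸ Subgroup.mem_top (c x))
        refine Subgroup.mem_map.mpr ⟨n⁻¹ * x, ?_, ?_⟩
        · simp [MonoidHom.mem_ker, hnx]
        · simp [MonoidHom.mem_ker.mp hn]
      obtain ⟨e, he, hmem⟩ := exists_ne_one_forall_mem_of_map_eq_range
        (ker_le_center_of_injective_comp hgen)
        (fun k _ => isOfFinOrder_of_injective_comp hgen k) hf hrange
      exact absurd (eq_one_of_injective_comp hgen hmem) he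
  let h : G →* G := c.liftOfSurjective hsurj ⟨f, hker⟩
  have hcomp : h.comp c = f := MonoidHom.liftOfRightInverse_comp ..
  have hinj : Function.Injective h := by
    rcases h.normal_ker.eq_bot_or_eq_top with hbot | htop
    · exact (MonoidHom.ker_eq_bot_iff h).mp hbot
    · refine absurd ?_ hf
      rw [← hcomp, (MonoidHom.ker_eq_top_iff).mp htop, MonoidHom.one_comp]
  exact ⟨MulEquiv.ofBijective h (Finite.injective_iff_bijective.mp hinj), hcomp.symm⟩
end
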